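/- Let H_ℤ = {A ∈ Sp(4,ℤ) : A₁₃, A₁₄, A₂₃, A₂₄, A₃₁, A₃₂, A₄₁, A₄₂ are all even}. Then the stabilizer {A ∈ H_ℤ : A·e₃ = e₃ or A·e₃ = −e₃} equals the subgroup of Sp(4,ℤ) generated by M², (M′)², τ_{e₁}, τ_{e₂}, τ_{e₃} and −I, where M is the matrix with rows (1,0,0,0), (0,1,0,1), (−1,0,1,0), (0,0,0,1), M′ is the matrix with rows (1,0,0,1), (0,1,0,0), (0,1,1,0), (0,0,0,1), and I is the identity matrix. -/

import Mathlib

open Matrix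

abbrev M4 := Matrix (Fin 4) (Fin 4) ℤ

/-- The standard symplectic form on `ℤ⁴`: `ω(x,y) = x₁y₂ − x₂y₁ + x₃y₄ − x₄y₃`
(written with 0-based indices). -/
def omegaZ (x y : Fin 4 → ℤ) : ℤ :=
  x 0 * y 1 - x 1 * y 0 + x 2 * y 3 - x 3 * y 2

/-- `A ∈ Sp(4,ℤ)`: `A` preserves the symplectic form `ω`. -/
def IsSymp (A : M4) : Prop :=
  ∀ x y : Fin 4 → ℤ, omegaZ (A.mulVec x) (A.mulVec y) = omegaZ x y

/-- `A ∈ H_ℤ = {A ∈ Sp(4,ℤ) : A₁₃, A₁₄, A₂₃, A₂₄, A₃₁, A₃₂, A₄₁, A₄₂ even}`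
(1-based entries). -/
def InHZ (A : M4) : Prop :=
  IsSymp A ∧ (2 : ℤ) ∣ A 0 2 ∧ (2 : ℤ) ∣ A 0 3 ∧ (2 : ℤ) ∣ A 1 2 ∧ (2 : ℤ) ∣ A 1 3 ∧
    (2 : ℤ) ∣ A 2 0 ∧ (2 : ℤ) ∣ A 2 1 ∧ (2 : ℤ) ∣ A 3 0 ∧ (2 : ℤ) ∣ A 3 1

/-- The symplectic transvection `τ_v(x) = x − ω(x,v)v`, as a matrix. -/
def tau (v : Fin 4 → ℤ) : M4 :=
  1 - Matrix.vecMulVec v ![v 1, -v 0, v 3, -v 2]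

/-- The matrix `M` of the paper. -/
def Mmat : M4 := !![1, 0, 0, 0; 0, 1, 0, 1; -1, 0, 1, 0; 0, 0, 0, 1]

/-- The matrix `M′` of the paper. -/
def Mpmat : M4 := !![1, 0, 0, 1; 0, 1, 0, 0; 0, 1, 1, 0; 0, 0, 0, 1]

/-- The stabilizer of `±e₃` in `H_ℤ`, viewed inside `GL(4,ℤ)`. -/
def stabE3H : Set (GL (Fin 4) ℤ) :=
  {A | InHZ (A : M4) ∧
    ((A : M4).mulVec ![0, 0, 1, 0] = ![0, 0, 1, 0] ∨
     (A : M4).mulVec ![0, 0, 1, 0] = -![0, 0, 1, 0])}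

/-- The generating set `M², (M′)², τ_{e₁}, τ_{e₂}, τ_{e₃}, −I`. -/
def gensE3H : Set (GL (Fin 4) ℤ) :=
  {g | (g : M4) = Mmat ^ 2} ∪
  {g | (g : M4) = Mpmat ^ 2} ∪
  {g | (g : M4) = tau ![1, 0, 0, 0]} ∪
  {g | (g : M4) = tau ![0, 1, 0, 0]} ∪
  {g | (g : M4) = tau ![0, 0, 1, 0]} ∪
  {g | (g : M4) = -1}

open Matrix MatrixGroups

/-- Block-diagonal embedding of `SL(2,ℤ)` acting on the span of `e₁, e₂`. -/
def blockHom : SL(2, ℤ) →* GL (Fin 4) ℤ :=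
  MonoidHom.toHomUnits
    { toFun := fun g => !![g 0 0, g 0 1, 0, 0; g 1 0, g 1 1, 0, 0; 0, 0, 1, 0; 0, 0, 0, 1]
      map_one' := by
        ext i j
        fin_cases i <;> fin_cases j <;> simp
      map_mul' := fun g h => by
        ext i j
        fin_cases i <;> fin_cases j <;> simp [mul_apply, Fin.sum_univ_succ] }

/-- The unipotent symplectic matrix fixing `e₃` and sending `e₄` to `(r, s, t, 1)`. -/
def heisMat (r s t : ℤ) : M4 := !![1, 0, 0, r; 0, 1, 0, s; -s, r, 1, t; 0, 0, 0, 1]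

lemma heisMat_mul (r s t r' s' t' : ℤ) :
    heisMat r s t * heisMat r' s' t' =
      heisMat (r + r') (s + s') (t + t' + r * s' - s * r') := by
  ext i j
  fin_cases i <;> fin_cases j <;>
    simp [heisMat, mul_apply, Fin.sum_univ_succ] <;> ring

lemma heisMat_zero : heisMat 0 0 0 = 1 := by
  ext i j
  fin_cases i <;> fin_cases j <;> simp [heisMat]

/-- The one-parameter subgroup `n ↦ heisMat (n r) (n s) (n t)`. -/
def heisLine (r s t : ℤ) : Multiplicative ℤ →* GL (Fin 4) ℤ :=
  MonoidHom.toHomUnits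
    { toFun := fun n => heisMat (n.toAdd * r) (n.toAdd * s) (n.toAdd * t)
      map_one' := by simp [heisMat_zero]
      map_mul' := fun m n => by
        rw [heisMat_mul, toAdd_mul]
        congr 1 <;> ring }

lemma heisLine_mem {K : Subgroup (GL (Fin 4) ℤ)} {r s t : ℤ}
    (h : heisLine r s t (Multiplicative.ofAdd 1) ∈ K) (n : ℤ) :
    heisLine r s t (Multiplicative.ofAdd n) ∈ K := by
  have hn : Multiplicative.ofAdd n = Multiplicative.ofAdd (1 : ℤ) ^ n := by
    rw [← ofAdd_zsmul]; simp
  rw [hn, map_zpow]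
  exact K.zpow_mem h n

lemma coe_heisLine (r s t n : ℤ) :
    (heisLine r s t (Multiplicative.ofAdd n) : M4) = heisMat (n * r) (n * s) (n * t) := rfl

lemma coe_blockHom (g : SL(2, ℤ)) :
    (blockHom g : M4) =
      !![g 0 0, g 0 1, 0, 0; g 1 0, g 1 1, 0, 0; 0, 0, 1, 0; 0, 0, 0, 1] := rfl

lemma Mmat_sq : Mmat ^ 2 = heisMat 0 2 0 := by
  ext i j
  fin_cases i <;> fin_cases j <;> decide

lemma Mpmat_sq : Mpmat ^ 2 = heisMat 2 0 0 := by
  ext i j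
  fin_cases i <;> fin_cases j <;> decide

lemma tau_e3 : tau ![0, 0, 1, 0] = heisMat 0 0 1 := by
  ext i j
  fin_cases i <;> fin_cases j <;> decide

lemma blockHom_mem_closure (g : SL(2, ℤ)) : blockHom g ∈ Subgroup.closure gensE3H := by
  have hT : blockHom ModularGroup.T ∈ Subgroup.closure gensE3H := by
    refine Subgroup.subset_closure (.inl (.inl (.inl (.inr ?_))))
    rw [Set.mem_ofPred_eq, coe_blockHom]
    ext i j
    fin_cases i <;> fin_cases j <;> decide
  let U : SL(2, ℤ) := ⟨!![1, 0; -1, 1], by simp⟩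
  have hU : blockHom U ∈ Subgroup.closure gensE3H := by
    refine Subgroup.subset_closure (.inl (.inl (.inr ?_)))
    rw [Set.mem_ofPred_eq, coe_blockHom]
    ext i j
    fin_cases i <;> fin_cases j <;> decide
  have hS : ModularGroup.S = (ModularGroup.T * U * ModularGroup.T)⁻¹ := by
    rw [eq_inv_iff_mul_eq_one]
    decide
  have hle : Subgroup.closure {ModularGroup.S, ModularGroup.T} ≤
      (Subgroup.closure gensE3H).comap blockHom := by
    rw [Subgroup.closure_le]
    rintro x (rfl | rfl)
    · rw [hS]
      exact inv_mem (mul_mem (mul_mem hT hU) hT)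
    · exact hT
  rw [SpecialLinearGroup.SL2Z_generators] at hle
  exact hle (Subgroup.mem_top g)

lemma mem_closure_of_coe_eq_heisMat {A : GL (Fin 4) ℤ} {m n t : ℤ}
    (hA : (A : M4) = heisMat (2 * m) (2 * n) t) : A ∈ Subgroup.closure gensE3H := by
  have h1 := heisLine_mem (K := Subgroup.closure gensE3H) (r := 0) (s := 2) (t := 0)
    (Subgroup.subset_closure (.inl (.inl (.inl (.inl (.inl (by
      rw [Set.mem_ofPred_eq, coe_heisLine, Mmat_sq]; rfl))))))) n
  have h2 := heisLine_mem (K := Subgroup.closure gensE3H) (r := 2) (s := 0) (t := 0)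
    (Subgroup.subset_closure (.inl (.inl (.inl (.inl (.inr (by
      rw [Set.mem_ofPred_eq, coe_heisLine, Mpmat_sq]; rfl))))))) m
  have h3 := heisLine_mem (K := Subgroup.closure gensE3H) (r := 0) (s := 0) (t := 1)
    (Subgroup.subset_closure (.inl (.inr (by
      rw [Set.mem_ofPred_eq, coe_heisLine, tau_e3]; rfl)))) (t + 4 * m * n)
  have hprod : A = heisLine 0 2 0 (Multiplicative.ofAdd n) *
      heisLine 2 0 0 (Multiplicative.ofAdd m) *
      heisLine 0 0 1 (Multiplicative.ofAdd (t + 4 * m * n)) := by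
    apply Units.ext
    rw [Units.val_mul, Units.val_mul, coe_heisLine, coe_heisLine, coe_heisLine,
      heisMat_mul, heisMat_mul, hA]
    congr 1 <;> ring
  rw [hprod]
  exact mul_mem (mul_mem h1 h2) h3

lemma mem_closure_of_fixes_e3 {A : GL (Fin 4) ℤ} (hA : InHZ (A : M4))
    (h3 : (A : M4).mulVec ![0, 0, 1, 0] = ![0, 0, 1, 0]) : A ∈ Subgroup.closure gensE3H := by
  obtain ⟨hs, -, ⟨m, hm⟩, -, ⟨n, hn⟩, -⟩ := hA
  have c0 : (A : M4) 0 2 = 0 := by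
    simpa [mulVec, dotProduct, Fin.sum_univ_succ] using congrFun h3 0
  have c1 : (A : M4) 1 2 = 0 := by
    simpa [mulVec, dotProduct, Fin.sum_univ_succ] using congrFun h3 1
  have c2 : (A : M4) 2 2 = 1 := by
    simpa [mulVec, dotProduct, Fin.sum_univ_succ] using congrFun h3 2
  have c3 : (A : M4) 3 2 = 0 := by
    simpa [mulVec, dotProduct, Fin.sum_univ_succ] using congrFun h3 3
  have r0 : (A : M4) 3 0 = 0 := by
    simpa [omegaZ, mulVec, dotProduct, Fin.sum_univ_succ, c0, c1, c2, c3] using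
      hs ![0, 0, 1, 0] ![1, 0, 0, 0]
  have r1 : (A : M4) 3 1 = 0 := by
    simpa [omegaZ, mulVec, dotProduct, Fin.sum_univ_succ, c0, c1, c2, c3] using
      hs ![0, 0, 1, 0] ![0, 1, 0, 0]
  have r3 : (A : M4) 3 3 = 1 := by
    simpa [omegaZ, mulVec, dotProduct, Fin.sum_univ_succ, c0, c1, c2, c3] using
      hs ![0, 0, 1, 0] ![0, 0, 0, 1]
  have hdet : (A : M4) 0 0 * (A : M4) 1 1 - (A : M4) 1 0 * (A : M4) 0 1 = 1 := by
    simpa [omegaZ, mulVec, dotProduct, Fin.sum_univ_succ, r0, r1] using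
      hs ![1, 0, 0, 0] ![0, 1, 0, 0]
  have hp : (A : M4) 0 0 * (A : M4) 1 3 - (A : M4) 1 0 * (A : M4) 0 3 + (A : M4) 2 0 = 0 := by
    simpa [omegaZ, mulVec, dotProduct, Fin.sum_univ_succ, r0, r3] using
      hs ![1, 0, 0, 0] ![0, 0, 0, 1]
  have hq : (A : M4) 0 1 * (A : M4) 1 3 - (A : M4) 1 1 * (A : M4) 0 3 + (A : M4) 2 1 = 0 := by
    simpa [omegaZ, mulVec, dotProduct, Fin.sum_univ_succ, r1, r3] using
      hs ![0, 1, 0, 0] ![0, 0, 0, 1]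
  rw [hm, hn] at hp hq
  let g : SL(2, ℤ) := ⟨!![(A : M4) 0 0, (A : M4) 0 1; (A : M4) 1 0, (A : M4) 1 1], by
    rw [det_fin_two_of]; linarith⟩
  have hprod : (A : M4) = heisMat (2 * m) (2 * n) ((A : M4) 2 3) * (blockHom g : M4) := by
    rw [coe_blockHom]
    ext i j
    fin_cases i <;> fin_cases j <;>
      simp [heisMat, mul_apply, Fin.sum_univ_succ, g, c0, c1, c2, c3, r0, r1, r3, hm, hn] <;>
      linarith
  have hN : ((A * (blockHom g)⁻¹ : GL (Fin 4) ℤ) : M4) =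
      heisMat (2 * m) (2 * n) ((A : M4) 2 3) := by
    rw [Units.val_mul, Units.mul_inv_eq_iff_eq_mul, ← hprod]
  have := mul_mem (mem_closure_of_coe_eq_heisMat hN) (blockHom_mem_closure g)
  rwa [inv_mul_cancel_right] at this

lemma IsSymp.neg {A : M4} (hA : IsSymp A) : IsSymp (-A) := by
  intro x y
  rw [← hA x y]
  simp only [omegaZ, neg_mulVec, Pi.neg_apply]
  ring

lemma InHZ.neg {A : M4} (hA : InHZ A) : InHZ (-A) := by
  obtain ⟨hs, h⟩ := hA
  exact ⟨hs.neg, by simpa only [Matrix.neg_apply, dvd_neg] using h⟩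

lemma InHZ.mul {A B : M4} (hA : InHZ A) (hB : InHZ B) : InHZ (A * B) := by
  obtain ⟨hs, a1, a2, a3, a4, a5, a6, a7, a8⟩ := hA
  obtain ⟨hs', b1, b2, b3, b4, b5, b6, b7, b8⟩ := hB
  refine ⟨fun x y => ?_, ?_⟩
  · rw [← mulVec_mulVec, ← mulVec_mulVec, hs, hs']
  · simp only [mul_apply, Fin.sum_univ_four]
    refine ⟨?_, ?_, ?_, ?_, ?_, ?_, ?_, ?_⟩ <;>
      refine dvd_add (dvd_add (dvd_add ?_ ?_) ?_) ?_ <;>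
      first
        | exact Dvd.dvd.mul_left (by assumption) _
        | exact Dvd.dvd.mul_right (by assumption) _

lemma InHZ.inv {A : GL (Fin 4) ℤ} (hA : InHZ (A : M4)) : InHZ ((A⁻¹ : GL (Fin 4) ℤ) : M4) := by
  obtain ⟨hs, a1, a2, a3, a4, a5, a6, a7, a8⟩ := hA
  have hadj (x y : Fin 4 → ℤ) : omegaZ (((A⁻¹ : GL (Fin 4) ℤ) : M4).mulVec x) y =
      omegaZ x ((A : M4).mulVec y) := by
    rw [← hs, mulVec_mulVec, ← Units.val_mul, mul_inv_cancel, Units.val_one, one_mulVec]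
  refine ⟨fun x y => ?_, ?_⟩
  · rw [hadj, mulVec_mulVec, ← Units.val_mul, mul_inv_cancel, Units.val_one, one_mulVec]
  generalize ((A⁻¹ : GL (Fin 4) ℤ) : M4) = B at hadj ⊢
  have e02 := hadj ![0, 0, 1, 0] ![0, 1, 0, 0]
  have e03 := hadj ![0, 0, 0, 1] ![0, 1, 0, 0]
  have e12 := hadj ![0, 0, 1, 0] ![1, 0, 0, 0]
  have e13 := hadj ![0, 0, 0, 1] ![1, 0, 0, 0]
  have e20 := hadj ![1, 0, 0, 0] ![0, 0, 0, 1]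
  have e21 := hadj ![0, 1, 0, 0] ![0, 0, 0, 1]
  have e30 := hadj ![1, 0, 0, 0] ![0, 0, 1, 0]
  have e31 := hadj ![0, 1, 0, 0] ![0, 0, 1, 0]
  simp [omegaZ, mulVec, dotProduct, Fin.sum_univ_succ] at e02 e03 e12 e13 e20 e21 e30 e31
  omega

/-- `stabE3H` as a subgroup of `GL(4,ℤ)`. -/
def stabE3HSubgroup : Subgroup (GL (Fin 4) ℤ) where
  carrier := stabE3H
  one_mem' := by
    refine ⟨⟨fun x y => by simp, by simp⟩, .inl (by simp)⟩
  mul_mem' := by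
    rintro A B ⟨hA, hA'⟩ ⟨hB, hB'⟩
    refine ⟨hA.mul hB, ?_⟩
    rw [Units.val_mul, ← mulVec_mulVec]
    rcases hB' with h | h <;> rcases hA' with h' | h' <;>
      simp only [h, h', mulVec_neg, neg_neg, true_or, or_true]
  inv_mem' := by
    rintro A ⟨hA, hA'⟩
    refine ⟨hA.inv, ?_⟩
    have hinv (x : Fin 4 → ℤ) :
        ((A⁻¹ : GL (Fin 4) ℤ) : M4).mulVec ((A : M4).mulVec x) = x := by
      rw [mulVec_mulVec, ← Units.val_mul, inv_mul_cancel, Units.val_one, one_mulVec]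
    have h := hinv ![0, 0, 1, 0]
    rcases hA' with h' | h' <;> rw [h'] at h
    · exact .inl h
    · rw [mulVec_neg, neg_eq_iff_eq_neg] at h
      exact .inr h

lemma isSymp_tau (v : Fin 4 → ℤ) : IsSymp (tau v) := by
  intro x y
  simp [tau, omegaZ, mulVec, dotProduct, Fin.sum_univ_succ, vecMulVec, Matrix.one_apply]
  ring

lemma isSymp_heisMat (r s t : ℤ) : IsSymp (heisMat r s t) := by
  intro x y
  simp [heisMat, omegaZ, mulVec, dotProduct, Fin.sum_univ_succ]
  ring

lemma gensE3H_subset_stabE3H : gensE3H ⊆ stabE3H := by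
  have key {A : GL (Fin 4) ℤ} {B : M4} (hAB : (A : M4) = B) (hs : IsSymp B)
      (h : ((2 : ℤ) ∣ B 0 2 ∧ (2 : ℤ) ∣ B 0 3 ∧ (2 : ℤ) ∣ B 1 2 ∧ (2 : ℤ) ∣ B 1 3 ∧
        (2 : ℤ) ∣ B 2 0 ∧ (2 : ℤ) ∣ B 2 1 ∧ (2 : ℤ) ∣ B 3 0 ∧ (2 : ℤ) ∣ B 3 1) ∧
        (B.mulVec ![0, 0, 1, 0] = ![0, 0, 1, 0] ∨ B.mulVec ![0, 0, 1, 0] = -![0, 0, 1, 0])) :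
      A ∈ stabE3H := by
    subst hAB
    exact ⟨⟨hs, h.1⟩, h.2⟩
  rintro A (((((hA | hA) | hA) | hA) | hA) | hA)
  · exact key (hA.trans Mmat_sq) (isSymp_heisMat _ _ _) (by decide)
  · exact key (hA.trans Mpmat_sq) (isSymp_heisMat _ _ _) (by decide)
  · exact key hA (isSymp_tau _) (by decide)
  · exact key hA (isSymp_tau _) (by decide)
  · exact key hA (isSymp_tau _) (by decide)
  · exact key hA (IsSymp.neg fun x y => by simp) (by decide)

/-- The stabilizer of `±e₃` in `H_ℤ` is generated by `M²`, `(M′)²`, `τ_{e₁}`, `τ_{e₂}`,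
`τ_{e₃}` and `−I`. -/
theorem stabilizer_e3_klein_eq_closure :
    stabE3H = (Subgroup.closure gensE3H : Set (GL (Fin 4) ℤ)) := by
  apply Set.Subset.antisymm
  · rintro A ⟨hA, h | h⟩
    · exact mem_closure_of_fixes_e3 hA h
    · have hneg : (-1 : GL (Fin 4) ℤ) ∈ Subgroup.closure gensE3H :=
        Subgroup.subset_closure (.inr (by simp))
      have hA' : -A ∈ Subgroup.closure gensE3H :=
        mem_closure_of_fixes_e3 (by simpa using hA.neg) (by
          rw [Units.val_neg, neg_mulVec, h, neg_neg])
      simpa using mul_mem hneg hA'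
  · exact (Subgroup.closure_le stabE3HSubgroup).mpr gensE3H_subset_stabE3H
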